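/- arXiv:2108.01611 — 4 statements merged into one kernel-verified Lean document; each statement's English description precedes it below -/
import Mathlib

section
/- Let K = (K_n)_{n≥1} be a matrix convex set in V with 0 ∈ K₁ and K₁ containing a nonzero point. If A ∈ K_r is a matrix exposed point of K, then for every invertible matrix γ ∈ M_r(ℂ) with tr(γ*γ) = 1, the point (γ*γ, γ*Aγ) is an exposed point of the convex set Γ_r(K) ⊆ M_r(ℂ) × M_r(V). -/
open scoped Matrix Kronecker ComplexOrder

noncomputable section

variable {V : Type*} [AddCommGroup V] [Module ℂ V]

/-- The matrix `γ* A γ` computed entrywise via the `ℂ`-action on `V`. -/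
def mconj {m n : ℕ} (γ : Matrix (Fin m) (Fin n) ℂ)
    (A : Matrix (Fin m) (Fin m) V) : Matrix (Fin n) (Fin n) V :=
  Matrix.of fun i j => ∑ k, ∑ l, (star (γ k i) * γ l j) • A k l

/-- A graded family `K = (K_n)` is a matrix convex set. -/
def IsMatrixConvex (K : ∀ n : ℕ, Set (Matrix (Fin n) (Fin n) V)) : Prop :=
  ∀ (k n : ℕ), 0 < k → 0 < n →
    ∀ (ns : Fin k → ℕ) (A : ∀ i : Fin k, Matrix (Fin (ns i)) (Fin (ns i)) V)
      (γ : ∀ i : Fin k, Matrix (Fin (ns i)) (Fin n) ℂ),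
      (∀ i, 0 < ns i) → (∀ i, A i ∈ K (ns i)) →
      (∑ i, (γ i)ᴴ * γ i) = 1 →
      (∑ i, mconj (γ i) (A i)) ∈ K n

/-- The `r`-th ampliation of `Φ : V → M_m(ℂ)` applied to `B ∈ M_r(V)`, as a matrix
indexed by `Fin m × Fin r` (block `(i,j)`, inner indices `(p,q)` ↦ `Φ (B i j) p q`). -/
def amplify {m r : ℕ} (Φ : V → Matrix (Fin m) (Fin m) ℂ)
    (B : Matrix (Fin r) (Fin r) V) : Matrix (Fin m × Fin r) (Fin m × Fin r) ℂ :=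
  Matrix.of fun p q => Φ (B p.2 q.2) p.1 q.1

/-- Hermitian part `(X + X*)/2` of a complex matrix. -/
def reM {ι : Type*} (X : Matrix ι ι ℂ) : Matrix ι ι ℂ := (2 : ℂ)⁻¹ • (X + Xᴴ)

section Top

variable [TopologicalSpace V]

/-- `(Φ, α)` matricially exposes the point `A ∈ K_n`. -/
def IsExposingPair (K : ∀ n : ℕ, Set (Matrix (Fin n) (Fin n) V)) {n : ℕ}
    (A : Matrix (Fin n) (Fin n) V)
    (Φ : V →L[ℂ] Matrix (Fin n) (Fin n) ℂ) (α : Matrix (Fin n) (Fin n) ℂ) : Prop :=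
  α.IsHermitian ∧
  (∀ r : ℕ, 0 < r → ∀ B ∈ K r,
    (α ⊗ₖ (1 : Matrix (Fin r) (Fin r) ℂ) - reM (amplify (⇑Φ) B)).PosSemidef) ∧
  {B | B ∈ K n ∧
      (α ⊗ₖ (1 : Matrix (Fin n) (Fin n) ℂ) - reM (amplify (⇑Φ) B)).PosSemidef ∧
      ¬ IsUnit (α ⊗ₖ (1 : Matrix (Fin n) (Fin n) ℂ) - reM (amplify (⇑Φ) B))} =
    {B | ∃ U ∈ Matrix.unitaryGroup (Fin n) ℂ, B = mconj U A}

/-- `A ∈ K_n` is a matrix exposed point of `K`. -/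
def IsMatrixExposed (K : ∀ n : ℕ, Set (Matrix (Fin n) (Fin n) V)) {n : ℕ}
    (A : Matrix (Fin n) (Fin n) V) : Prop :=
  ∃ (Φ : V →L[ℂ] Matrix (Fin n) (Fin n) ℂ) (α : Matrix (Fin n) (Fin n) ℂ),
    IsExposingPair K A Φ α

end Top

/-- Classical exposed point of a set in a topological `ℂ`-vector space. -/
def IsExposedPoint {W : Type*} [AddCommGroup W] [Module ℂ W] [TopologicalSpace W]
    (C : Set W) (x : W) : Prop :=
  x ∈ C ∧ ∃ (φ : W →L[ℂ] ℂ) (a : ℝ),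
    (φ x).re = a ∧ ∀ y ∈ C, y ≠ x → (φ y).re < a

/-- Classical exposed face of a set in a topological `ℂ`-vector space. -/
def IsExposedFaceOf {W : Type*} [AddCommGroup W] [Module ℂ W] [TopologicalSpace W]
    (C F : Set W) : Prop :=
  F ⊆ C ∧ ∃ (φ : W →L[ℂ] ℂ) (a : ℝ),
    (∀ x ∈ F, (φ x).re = a) ∧ ∀ y ∈ C, y ∉ F → (φ y).re < a

/-- `A ∈ K_n` is a matrix extreme point of the graded family `K`. -/
def IsMatrixExtreme (K : ∀ n : ℕ, Set (Matrix (Fin n) (Fin n) V)) {n : ℕ}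
    (A : Matrix (Fin n) (Fin n) V) : Prop :=
  A ∈ K n ∧
  ∀ (k : ℕ), 0 < k →
    ∀ (ns : Fin k → ℕ) (Ai : ∀ i : Fin k, Matrix (Fin (ns i)) (Fin (ns i)) V)
      (γ : ∀ i : Fin k, Matrix (Fin (ns i)) (Fin n) ℂ),
      (∀ i, 0 < ns i) → (∀ i, Ai i ∈ K (ns i)) →
      (∀ i, Function.Surjective (γ i).mulVec) →
      (∑ i, (γ i)ᴴ * γ i) = 1 →
      (∑ i, mconj (γ i) (Ai i)) = A →
      ∀ i, ∃ (h : ns i = n) (U : Matrix (Fin n) (Fin n) ℂ),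
        U ∈ Matrix.unitaryGroup (Fin n) ℂ ∧
        Matrix.reindex (finCongr h) (finCongr h) (Ai i) = mconj U A

/-- `Γ_n(K)`. -/
def GammaSet (K : ∀ n : ℕ, Set (Matrix (Fin n) (Fin n) V)) (n : ℕ) :
    Set (Matrix (Fin n) (Fin n) ℂ × Matrix (Fin n) (Fin n) V) :=
  {P | ∃ (k : ℕ), 0 < k ∧ ∃ (A : Matrix (Fin k) (Fin k) V) (γ : Matrix (Fin k) (Fin n) ℂ),
    A ∈ K k ∧ (γᴴ * γ).trace = 1 ∧ P = (γᴴ * γ, mconj γ A)}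

/-- Matrix face `F ⊆ K_n`. -/
def IsMatrixFace (K : ∀ n : ℕ, Set (Matrix (Fin n) (Fin n) V)) {n : ℕ}
    (F : Set (Matrix (Fin n) (Fin n) V)) : Prop :=
  F ⊆ K n ∧ Convex ℝ F ∧
  ∀ (k : ℕ), 0 < k →
    ∀ (ns : Fin k → ℕ) (Ai : ∀ i : Fin k, Matrix (Fin (ns i)) (Fin (ns i)) V)
      (γ : ∀ i : Fin k, Matrix (Fin (ns i)) (Fin n) ℂ),
      (∀ i, 0 < ns i) → (∀ i, Ai i ∈ K (ns i)) →
      (∀ i, Function.Surjective (γ i).mulVec) →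
      (∑ i, (γ i)ᴴ * γ i) = 1 →
      (∑ i, mconj (γ i) (Ai i)) ∈ F →
      ∀ i, ∃ h : ns i = n, Matrix.reindex (finCongr h) (finCongr h) (Ai i) ∈ F

/-- `A` is a `C*`-extreme point of `F ⊆ M_n(V)`. -/
def IsCStarExtreme {n : ℕ} (F : Set (Matrix (Fin n) (Fin n) V))
    (A : Matrix (Fin n) (Fin n) V) : Prop :=
  A ∈ F ∧
  ∀ (k : ℕ), 0 < k →
    ∀ (Ai : Fin k → Matrix (Fin n) (Fin n) V) (γ : Fin k → Matrix (Fin n) (Fin n) ℂ),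
      (∀ i, Ai i ∈ F) → (∀ i, IsUnit (γ i)) →
      (∑ i, (γ i)ᴴ * γ i) = 1 →
      (∑ i, mconj (γ i) (Ai i)) = A →
      ∀ i, ∃ U ∈ Matrix.unitaryGroup (Fin n) ℂ, Ai i = mconj U A

section Top2

variable [TopologicalSpace V]

/-- `(Φ, α)` is an exposing pair for the face `F ⊆ K_n`. -/
def IsFaceExposingPair (K : ∀ n : ℕ, Set (Matrix (Fin n) (Fin n) V)) {n : ℕ}
    (F : Set (Matrix (Fin n) (Fin n) V))
    (Φ : V →L[ℂ] Matrix (Fin n) (Fin n) ℂ) (α : Matrix (Fin n) (Fin n) ℂ) : Prop :=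
  α.IsHermitian ∧
  (∀ m : ℕ, 0 < m → ∀ B ∈ K m,
    (α ⊗ₖ (1 : Matrix (Fin m) (Fin m) ℂ) - reM (amplify (⇑Φ) B)).PosSemidef) ∧
  (∀ m : ℕ, 0 < m → m < n → ∀ B ∈ K m,
    (α ⊗ₖ (1 : Matrix (Fin m) (Fin m) ℂ) - reM (amplify (⇑Φ) B)).PosDef) ∧
  {B | B ∈ K n ∧
      (α ⊗ₖ (1 : Matrix (Fin n) (Fin n) ℂ) - reM (amplify (⇑Φ) B)).PosSemidef ∧
      ¬ IsUnit (α ⊗ₖ (1 : Matrix (Fin n) (Fin n) ℂ) - reM (amplify (⇑Φ) B))} = F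

/-- `F ⊆ K_n` is a matrix exposed face of `K`. -/
def IsMatrixExposedFace (K : ∀ n : ℕ, Set (Matrix (Fin n) (Fin n) V)) {n : ℕ}
    (F : Set (Matrix (Fin n) (Fin n) V)) : Prop :=
  F ⊆ K n ∧ Convex ℝ F ∧
  ∃ (Φ : V →L[ℂ] Matrix (Fin n) (Fin n) ℂ) (α : Matrix (Fin n) (Fin n) ℂ),
    IsFaceExposingPair K F Φ α

/-- The unitary orbit of `F ⊆ M_n(V)`. -/
def unitaryOrbit {n : ℕ} (F : Set (Matrix (Fin n) (Fin n) V)) :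
    Set (Matrix (Fin n) (Fin n) V) :=
  {B | ∃ A ∈ F, ∃ U ∈ Matrix.unitaryGroup (Fin n) ℂ, B = mconj U A}

/-- `F ⊆ K_n` is a weak matrix exposed face of `K`. -/
def IsWeakMatrixExposedFace (K : ∀ n : ℕ, Set (Matrix (Fin n) (Fin n) V)) {n : ℕ}
    (F : Set (Matrix (Fin n) (Fin n) V)) : Prop :=
  F ⊆ K n ∧ Convex ℝ F ∧
  ∃ (Φ : V →L[ℂ] Matrix (Fin n) (Fin n) ℂ) (α : Matrix (Fin n) (Fin n) ℂ),
    α.IsHermitian ∧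
    (∀ m : ℕ, 0 < m → ∀ B ∈ K m,
      (α ⊗ₖ (1 : Matrix (Fin m) (Fin m) ℂ) - reM (amplify (⇑Φ) B)).PosSemidef) ∧
    (∀ m : ℕ, 0 < m → m < n → ∀ B ∈ K m,
      (α ⊗ₖ (1 : Matrix (Fin m) (Fin m) ℂ) - reM (amplify (⇑Φ) B)).PosDef) ∧
    {B | B ∈ K n ∧
        (α ⊗ₖ (1 : Matrix (Fin n) (Fin n) ℂ) - reM (amplify (⇑Φ) B)).PosSemidef ∧
        ¬ IsUnit (α ⊗ₖ (1 : Matrix (Fin n) (Fin n) ℂ) - reM (amplify (⇑Φ) B))} =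
      unitaryOrbit F

end Top2

/-- `F = (F_n)` is a matrix multiface of `K`. -/
def IsMatrixMultiface (K F : ∀ n : ℕ, Set (Matrix (Fin n) (Fin n) V)) : Prop :=
  (∀ n, F n ⊆ K n) ∧ (∀ n, Convex ℝ (F n)) ∧
  ∀ (k n : ℕ), 0 < k → 0 < n →
    ∀ (ns : Fin k → ℕ) (Ai : ∀ i : Fin k, Matrix (Fin (ns i)) (Fin (ns i)) V)
      (γ : ∀ i : Fin k, Matrix (Fin (ns i)) (Fin n) ℂ),
      (∀ i, 0 < ns i) → (∀ i, Ai i ∈ K (ns i)) →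
      (∀ i, Function.Surjective (γ i).mulVec) →
      (∑ i, (γ i)ᴴ * γ i) = 1 →
      (∑ i, mconj (γ i) (Ai i)) ∈ F n →
      ∀ i, Ai i ∈ F (ns i)

section Top3

variable [TopologicalSpace V]

/-- `F = (F_n)` is a matrix exposed multiface of `K`. -/
def IsMatrixExposedMultiface (K F : ∀ n : ℕ, Set (Matrix (Fin n) (Fin n) V)) : Prop :=
  (∀ n, F n ⊆ K n) ∧ (∀ n, Convex ℝ (F n)) ∧
  ∃ (r : ℕ), 0 < r ∧
    ∃ (Φ : V →L[ℂ] Matrix (Fin r) (Fin r) ℂ) (α : Matrix (Fin r) (Fin r) ℂ),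
      α.IsHermitian ∧
      (∀ n : ℕ, 0 < n → ∀ B ∈ K n,
        (α ⊗ₖ (1 : Matrix (Fin n) (Fin n) ℂ) - reM (amplify (⇑Φ) B)).PosSemidef) ∧
      (∀ n : ℕ, 0 < n →
        {B | B ∈ K n ∧
            (α ⊗ₖ (1 : Matrix (Fin n) (Fin n) ℂ) - reM (amplify (⇑Φ) B)).PosSemidef ∧
            ¬ IsUnit (α ⊗ₖ (1 : Matrix (Fin n) (Fin n) ℂ) - reM (amplify (⇑Φ) B))} = F n)

end Top3

end

section MatrixConvex

variable {V : Type*} [AddCommGroup V] [Module ℂ V]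

lemma mconj_one {n : ℕ} (A : Matrix (Fin n) (Fin n) V) : mconj 1 A = A := by
  ext i j
  simp [mconj, Matrix.one_apply, ite_smul]

lemma mconj_add {m n : ℕ} (γ : Matrix (Fin m) (Fin n) ℂ) (A B : Matrix (Fin m) (Fin m) V) :
    mconj γ (A + B) = mconj γ A + mconj γ B := by
  ext i j
  simp [mconj, smul_add, Finset.sum_add_distrib]

lemma mconj_smul {m n : ℕ} (γ : Matrix (Fin m) (Fin n) ℂ) (z : ℂ)
    (A : Matrix (Fin m) (Fin m) V) : mconj γ (z • A) = z • mconj γ A := by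
  ext i j
  simp [mconj, Finset.smul_sum, smul_comm z]

lemma mconj_mul {l m n : ℕ} (γ : Matrix (Fin l) (Fin m) ℂ) (δ : Matrix (Fin m) (Fin n) ℂ)
    (A : Matrix (Fin l) (Fin l) V) : mconj (γ * δ) A = mconj δ (mconj γ A) := by
  ext i j
  simp only [mconj, Matrix.of_apply, Matrix.mul_apply, star_sum, star_mul', Finset.sum_mul_sum,
    Finset.smul_sum, Finset.sum_smul, smul_smul]
  trans ∑ k, ∑ a, ∑ b, ∑ l, (star (γ k a) * star (δ a i) * (γ l b * δ b j)) • A k l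
  · refine Finset.sum_congr rfl fun k _ => ?_
    rw [Finset.sum_comm]
    exact Finset.sum_congr rfl fun a _ => Finset.sum_comm
  · rw [Finset.sum_comm]
    refine Finset.sum_congr rfl fun a _ => ?_
    rw [Finset.sum_comm]
    refine Finset.sum_congr rfl fun b _ => Finset.sum_congr rfl fun k _ =>
      Finset.sum_congr rfl fun l _ => ?_
    congr 1
    ring

lemma mconj_zero_left {m n : ℕ} (A : Matrix (Fin m) (Fin m) V) :
    mconj (0 : Matrix (Fin m) (Fin n) ℂ) A = 0 := by
  ext i j
  simp [mconj]

lemma mconj_smul_left {m n : ℕ} (z : ℂ) (γ : Matrix (Fin m) (Fin n) ℂ)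
    (A : Matrix (Fin m) (Fin m) V) : mconj (z • γ) A = (star z * z) • mconj γ A := by
  ext i j
  simp only [mconj, Matrix.of_apply, Matrix.smul_apply, Finset.smul_sum, smul_smul, smul_eq_mul,
    star_mul']
  refine Finset.sum_congr rfl fun k _ => Finset.sum_congr rfl fun l _ => ?_
  congr 1
  ring

lemma trace_mconj {m n : ℕ} {γ : Matrix (Fin m) (Fin n) ℂ} (hγ : γ * γᴴ = 1)
    (A : Matrix (Fin m) (Fin m) V) : (mconj γ A).trace = A.trace := by
  have h (k l : Fin m) : ∑ i, star (γ k i) * γ l i = (1 : Matrix (Fin m) (Fin m) ℂ) l k := by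
    rw [← hγ, Matrix.mul_apply]
    exact Finset.sum_congr rfl fun i _ => by simp [mul_comm]
  simp only [Matrix.trace, Matrix.diag, mconj, Matrix.of_apply]
  rw [Finset.sum_comm]
  refine Finset.sum_congr rfl fun k _ => ?_
  rw [Finset.sum_comm]
  simp only [← Finset.sum_smul, h, Matrix.one_apply, ite_smul, one_smul, zero_smul,
    Finset.sum_ite_eq', Finset.mem_univ, if_true]

namespace IsMatrixConvex

variable {K : ∀ n : ℕ, Set (Matrix (Fin n) (Fin n) V)}

lemma mconj_mem (hK : IsMatrixConvex K) {m n : ℕ} (hm : 0 < m) (hn : 0 < n)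
    {A : Matrix (Fin m) (Fin m) V} (hA : A ∈ K m) {γ : Matrix (Fin m) (Fin n) ℂ}
    (hγ : γᴴ * γ = 1) : mconj γ A ∈ K n := by
  simpa using hK 1 n one_pos hn (fun _ => m) (fun _ => A) (fun _ => γ) (fun _ => hm)
    (fun _ => hA) (by simpa using hγ)

lemma mconj_add_mconj_mem (hK : IsMatrixConvex K) {l m n : ℕ} (hl : 0 < l) (hm : 0 < m)
    (hn : 0 < n) {A : Matrix (Fin l) (Fin l) V} (hA : A ∈ K l)
    {B : Matrix (Fin m) (Fin m) V} (hB : B ∈ K m) {γ : Matrix (Fin l) (Fin n) ℂ}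
    {δ : Matrix (Fin m) (Fin n) ℂ} (h : γᴴ * γ + δᴴ * δ = 1) :
    mconj γ A + mconj δ B ∈ K n := by
  let ns : Fin 2 → ℕ := fun i => Fin.cases l (fun _ => m) i
  let C : ∀ i : Fin 2, Matrix (Fin (ns i)) (Fin (ns i)) V :=
    fun i => Fin.cases (motive := fun i => Matrix (Fin (ns i)) (Fin (ns i)) V) A (fun _ => B) i
  let ε : ∀ i : Fin 2, Matrix (Fin (ns i)) (Fin n) ℂ :=
    fun i => Fin.cases (motive := fun i => Matrix (Fin (ns i)) (Fin n) ℂ) γ (fun _ => δ) i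
  have := hK 2 n two_pos hn ns C ε
    (fun i => Fin.cases (motive := fun i => 0 < ns i) hl (fun _ => hm) i)
    (fun i => Fin.cases (motive := fun i => C i ∈ K (ns i)) hA (fun _ => hB) i)
    (by rw [Fin.sum_univ_two]; exact h)
  rw [Fin.sum_univ_two] at this
  exact this

end IsMatrixConvex

/-- The coisometry `ℂ^(k+1) → ℂ^k` forgetting the last coordinate. -/
def initProj (k : ℕ) : Matrix (Fin k) (Fin (k + 1)) ℂ :=
  Matrix.of fun i j => if i.castSucc = j then 1 else 0

/-- The coisometry `ℂ^(k+1) → ℂ` onto the last coordinate. -/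
def lastProj (k : ℕ) : Matrix (Fin 1) (Fin (k + 1)) ℂ :=
  Matrix.of fun _ j => if Fin.last k = j then 1 else 0

lemma initProj_mul_conjTranspose (k : ℕ) : initProj k * (initProj k)ᴴ = 1 := by
  ext i j
  simp [initProj, Matrix.mul_apply, Matrix.one_apply, eq_comm]

lemma lastProj_mul_conjTranspose (k : ℕ) : lastProj k * (lastProj k)ᴴ = 1 := by
  ext i j
  simp [lastProj, Matrix.mul_apply, Matrix.one_apply, Subsingleton.elim i j]

lemma lastProj_mul_conjTranspose_initProj (k : ℕ) : lastProj k * (initProj k)ᴴ = 0 := by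
  ext i j
  simp [lastProj, initProj, Matrix.mul_apply, (Fin.castSucc_ne_last j).symm]

lemma initProj_add_lastProj (k : ℕ) :
    (initProj k)ᴴ * initProj k + (lastProj k)ᴴ * lastProj k = 1 := by
  ext i j
  simp only [initProj, lastProj, Matrix.add_apply, Matrix.mul_apply, Matrix.conjTranspose_apply,
    Matrix.of_apply, Matrix.one_apply]
  refine Fin.lastCases ?_ (fun i => ?_) i <;> refine Fin.lastCases ?_ (fun j => ?_) j <;>
    simp [Fin.castSucc_ne_last, (Fin.castSucc_ne_last _).symm, eq_comm]

/-- Every complex matrix factors through an isometry from a space of dimension its rank. -/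
lemma Matrix.exists_isometry_mul_eq {m n : ℕ} (δ : Matrix (Fin m) (Fin n) ℂ) :
    ∃ (s : ℕ) (ι : Matrix (Fin m) (Fin s) ℂ) (ε : Matrix (Fin s) (Fin n) ℂ),
      s = δ.rank ∧ ιᴴ * ι = 1 ∧ δ = ι * ε := by
  let T := Matrix.toEuclideanLin δ
  let b := stdOrthonormalBasis ℂ (LinearMap.range T)
  let ι : Matrix (Fin m) (Fin (Module.finrank ℂ (LinearMap.range T))) ℂ :=
    Matrix.of fun i j => (b j : EuclideanSpace ℂ (Fin m)) i
  refine ⟨_, ι, ιᴴ * δ, δ.rank_eq_finrank_range_toLin (PiLp.basisFun 2 ℂ _)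
    (PiLp.basisFun 2 ℂ _) |>.symm, ?_, ?_⟩
  · ext i j
    have := orthonormal_iff_ite.mp b.orthonormal i j
    rw [Submodule.coe_inner, PiLp.inner_apply] at this
    simpa [ι, Matrix.mul_apply, Matrix.one_apply, mul_comm] using this
  · ext i j
    let x : LinearMap.range T := ⟨T (EuclideanSpace.single j 1), LinearMap.mem_range_self _ _⟩
    have hx (a) : (x : EuclideanSpace ℂ (Fin m)) a = δ a j := by
      simp [x, T, Matrix.toEuclideanLin]
    have := congrArg (fun y : LinearMap.range T => (y : EuclideanSpace ℂ (Fin m)) i) (b.sum_repr' x)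
    simp only [Submodule.coe_sum, Submodule.coe_smul, Submodule.coe_inner, PiLp.inner_apply,
      WithLp.ofLp_sum, Finset.sum_apply, hx, PiLp.smul_apply, smul_eq_mul] at this
    rw [← this, Matrix.mul_apply]
    refine Finset.sum_congr rfl fun k _ => ?_
    simp [ι, Matrix.mul_apply, mul_comm]

lemma re_star_dotProduct_reM_mulVec {ι : Type*} [Fintype ι] (X : Matrix ι ι ℂ) (z : ι → ℂ) :
    (star z ⬝ᵥ reM X *ᵥ z).re = (star z ⬝ᵥ X *ᵥ z).re := by
  have h : star z ⬝ᵥ Xᴴ *ᵥ z = star (star z ⬝ᵥ X *ᵥ z) := by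
    rw [Matrix.star_dotProduct, Matrix.star_mulVec, Matrix.conjTranspose_conjTranspose,
      Matrix.dotProduct_mulVec]
  rw [reM, Matrix.smul_mulVec, Matrix.add_mulVec, dotProduct_smul, dotProduct_add, h]
  simp
  ring

lemma vec_dotProduct_kronecker_one {m k : ℕ} (α : Matrix (Fin m) (Fin m) ℂ)
    (Y : Matrix (Fin k) (Fin m) ℂ) :
    star Y.vec ⬝ᵥ (α ⊗ₖ (1 : Matrix (Fin k) (Fin k) ℂ)) *ᵥ Y.vec =
      ∑ p, ∑ q, α p q * (Yᴴ * Y) p q := by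
  simp only [dotProduct, Matrix.mulVec, Fintype.sum_prod_type, Matrix.kroneckerMap_apply,
    Matrix.one_apply, Matrix.mul_apply, Finset.mul_sum, Matrix.vec, Pi.star_apply,
    Matrix.conjTranspose_apply]
  refine Finset.sum_congr rfl fun p _ => ?_
  rw [Finset.sum_comm]
  refine Finset.sum_congr rfl fun q _ => Finset.sum_congr rfl fun i _ => ?_
  simp
  ring

lemma vec_dotProduct_amplify {m k : ℕ} (Φ : V →ₗ[ℂ] Matrix (Fin m) (Fin m) ℂ)
    (B : Matrix (Fin k) (Fin k) V) (Y : Matrix (Fin k) (Fin m) ℂ) :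
    star Y.vec ⬝ᵥ amplify (⇑Φ) B *ᵥ Y.vec = ∑ p, ∑ q, Φ (mconj Y B p q) p q := by
  simp only [dotProduct, Matrix.mulVec, Fintype.sum_prod_type, amplify, mconj,
    Finset.mul_sum, Matrix.vec, Pi.star_apply, Matrix.of_apply, map_sum, map_smul,
    Matrix.sum_apply, Matrix.smul_apply, smul_eq_mul]
  refine Finset.sum_congr rfl fun p _ => ?_
  rw [Finset.sum_comm]
  refine Finset.sum_congr rfl fun q _ => Finset.sum_congr rfl fun i _ =>
    Finset.sum_congr rfl fun j _ => ?_
  ring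

/-- The Hermitian matrix `α ⊗ 1 - Re Φ(B)`. -/
noncomputable abbrev pencil {m k : ℕ} (Φ : V →ₗ[ℂ] Matrix (Fin m) (Fin m) ℂ) (α : Matrix (Fin m) (Fin m) ℂ)
    (B : Matrix (Fin k) (Fin k) V) : Matrix (Fin m × Fin k) (Fin m × Fin k) ℂ :=
  α ⊗ₖ (1 : Matrix (Fin k) (Fin k) ℂ) - reM (amplify (⇑Φ) B)

/-- The functional through which the quadratic form of `pencil Φ α B` at `Y` depends on
`(Y* Y, Y* B Y)`. -/
noncomputable def pencilForm {m : ℕ} (Φ : V →ₗ[ℂ] Matrix (Fin m) (Fin m) ℂ) (α : Matrix (Fin m) (Fin m) ℂ)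
    (M : Matrix (Fin m) (Fin m) ℂ) (W : Matrix (Fin m) (Fin m) V) : ℂ :=
  ∑ p, ∑ q, Φ (W p q) p q - ∑ p, ∑ q, α p q * M p q

section Pencil

variable {m k : ℕ} {Φ : V →ₗ[ℂ] Matrix (Fin m) (Fin m) ℂ} {α : Matrix (Fin m) (Fin m) ℂ}
  {B : Matrix (Fin k) (Fin k) V}

lemma re_pencilForm (Y : Matrix (Fin k) (Fin m) ℂ) :
    (pencilForm Φ α (Yᴴ * Y) (mconj Y B)).re = -(star Y.vec ⬝ᵥ pencil Φ α B *ᵥ Y.vec).re := by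
  rw [pencil, Matrix.sub_mulVec, dotProduct_sub, Complex.sub_re, re_star_dotProduct_reM_mulVec,
    vec_dotProduct_kronecker_one, vec_dotProduct_amplify, pencilForm, Complex.sub_re, neg_sub]

lemma re_pencilForm_nonpos (hB : (pencil Φ α B).PosSemidef) (Y : Matrix (Fin k) (Fin m) ℂ) :
    (pencilForm Φ α (Yᴴ * Y) (mconj Y B)).re ≤ 0 := by
  rw [re_pencilForm, neg_nonpos]
  exact (Complex.le_def.mp (hB.dotProduct_mulVec_nonneg _)).1

lemma pencil_mulVec_eq_zero_iff (hB : (pencil Φ α B).PosSemidef) (Y : Matrix (Fin k) (Fin m) ℂ) :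
    pencil Φ α B *ᵥ Y.vec = 0 ↔ (pencilForm Φ α (Yᴴ * Y) (mconj Y B)).re = 0 := by
  rw [re_pencilForm, neg_eq_zero, ← hB.dotProduct_mulVec_zero_iff]
  refine ⟨fun h => by rw [h, Complex.zero_re], fun h => ?_⟩
  have := Complex.le_def.mp (hB.dotProduct_mulVec_nonneg Y.vec)
  exact Complex.ext h this.2.symm

lemma pencil_mconj_mulVec_eq_zero_iff {s : ℕ} (hB : (pencil Φ α B).PosSemidef)
    {ι : Matrix (Fin k) (Fin s) ℂ} (hι : ιᴴ * ι = 1)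
    (hιB : (pencil Φ α (mconj ι B)).PosSemidef) (Y : Matrix (Fin s) (Fin m) ℂ) :
    pencil Φ α (mconj ι B) *ᵥ Y.vec = 0 ↔ pencil Φ α B *ᵥ (ι * Y).vec = 0 := by
  rw [pencil_mulVec_eq_zero_iff hB, pencil_mulVec_eq_zero_iff hιB, mconj_mul,
    Matrix.conjTranspose_mul, Matrix.mul_assoc, ← Matrix.mul_assoc ιᴴ, hι, Matrix.one_mul]

lemma not_isUnit_pencil_iff :
    ¬ IsUnit (pencil Φ α B) ↔
      ∃ Y : Matrix (Fin k) (Fin m) ℂ, Y ≠ 0 ∧ pencil Φ α B *ᵥ Y.vec = 0 := by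
  rw [Matrix.isUnit_iff_isUnit_det, isUnit_iff_ne_zero, not_not,
    ← Matrix.exists_mulVec_eq_zero_iff]
  constructor
  · rintro ⟨v, hv, h⟩
    refine ⟨Matrix.of fun i p => v (p, i), fun h0 => hv ?_, h⟩
    ext ⟨p, i⟩
    exact congrFun (congrFun h0 i) p
  · rintro ⟨Y, hY, h⟩
    exact ⟨Y.vec, fun h0 => hY (Matrix.vec_eq_zero_iff.mp h0), h⟩

end Pencil

section Exposed

variable {K : ∀ n : ℕ, Set (Matrix (Fin n) (Fin n) V)} {r : ℕ}
  {A : Matrix (Fin r) (Fin r) V}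
  {Φ : V →ₗ[ℂ] Matrix (Fin r) (Fin r) ℂ} {α : Matrix (Fin r) (Fin r) ℂ}

/-- Below the level of the exposed point the pencil is nonsingular. -/
lemma not_pencil_singular_of_lt (hK : IsMatrixConvex K)
    (h0 : (0 : Matrix (Fin 1) (Fin 1) V) ∈ K 1) {w : Matrix (Fin 1) (Fin 1) V} (hw : w ∈ K 1)
    (hw0 : w ≠ 0) (hpos : ∀ k, 0 < k → ∀ B ∈ K k, (pencil Φ α B).PosSemidef)
    (hexp : ∀ B ∈ K r, ¬ IsUnit (pencil Φ α B) →
      ∃ U ∈ Matrix.unitaryGroup (Fin r) ℂ, B = mconj U A)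
    {k : ℕ} (hk : 0 < k) (hkr : k < r) {B : Matrix (Fin k) (Fin k) V} (hB : B ∈ K k) :
    IsUnit (pencil Φ α B) := by
  have sum_mem {k : ℕ} (hk : 0 < k) {B : Matrix (Fin k) (Fin k) V} (hB : B ∈ K k)
      {v : Matrix (Fin 1) (Fin 1) V} (hv : v ∈ K 1) :
      mconj (initProj k) B + mconj (lastProj k) v ∈ K (k + 1) :=
    hK.mconj_add_mconj_mem hk one_pos k.succ_pos hB hv (initProj_add_lastProj k)
  have sum_singular {k : ℕ} (hk : 0 < k) {B : Matrix (Fin k) (Fin k) V} (hB : B ∈ K k)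
      (hs : ¬ IsUnit (pencil Φ α B)) {v : Matrix (Fin 1) (Fin 1) V} (hv : v ∈ K 1) :
      ¬ IsUnit (pencil Φ α (mconj (initProj k) B + mconj (lastProj k) v)) := by
    obtain ⟨Y, hY, h⟩ := not_isUnit_pencil_iff.mp hs
    have hinit : initProj k * ((initProj k)ᴴ * Y) = Y := by
      rw [← Matrix.mul_assoc, initProj_mul_conjTranspose, Matrix.one_mul]
    refine not_isUnit_pencil_iff.mpr ⟨(initProj k)ᴴ * Y, fun h' => hY ?_, ?_⟩
    · rw [← hinit, h', Matrix.mul_zero]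
    · rw [pencil_mulVec_eq_zero_iff (hpos _ hk _ hB)] at h
      rw [pencil_mulVec_eq_zero_iff (hpos _ k.succ_pos _ (sum_mem hk hB hv)), mconj_add,
        ← mconj_mul, ← mconj_mul, hinit, ← Matrix.mul_assoc (lastProj k),
        lastProj_mul_conjTranspose_initProj, Matrix.zero_mul, mconj_zero_left, add_zero,
        Matrix.conjTranspose_mul, Matrix.conjTranspose_conjTranspose, Matrix.mul_assoc, hinit, h]
  by_contra hs
  obtain ⟨j, rfl⟩ : ∃ j, r = j + 1 := ⟨r - 1, by omega⟩
  obtain ⟨C, hC, hCs⟩ : ∃ C ∈ K j, ¬ IsUnit (pencil Φ α C) := by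
    refine Nat.le_induction (m := k) (P := fun n _ => ∃ C ∈ K n, ¬ IsUnit (pencil Φ α C))
      ⟨B, hB, hs⟩ (fun n hn ⟨C, hC, hCs⟩ => ?_) j (by omega)
    exact ⟨_, sum_mem (by omega) hC h0, sum_singular (by omega) hC hCs h0⟩
  have hj : 0 < j := by omega
  have trace_eq {v : Matrix (Fin 1) (Fin 1) V} (hv : v ∈ K 1) : C.trace + v.trace = A.trace := by
    obtain ⟨U, hU, h⟩ := hexp _ (sum_mem hj hC hv) (sum_singular hj hC hCs hv)
    rw [← trace_mconj (Matrix.mem_unitaryGroup_iff.mp hU), ← h, Matrix.trace_add,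
      trace_mconj (initProj_mul_conjTranspose j), trace_mconj (lastProj_mul_conjTranspose j)]
  have hwt : w.trace = (0 : Matrix (Fin 1) (Fin 1) V).trace :=
    add_left_cancel ((trace_eq hw).trans (trace_eq h0).symm)
  refine hw0 (Matrix.ext fun i j => ?_)
  simpa [Matrix.trace, Subsingleton.elim i 0, Subsingleton.elim j 0] using hwt

/-- A nonzero kernel vector of the pencil, viewed as a matrix, has full rank. -/
lemma rank_eq_of_pencil_mulVec_eq_zero (hK : IsMatrixConvex K)
    (hpos : ∀ k, 0 < k → ∀ B ∈ K k, (pencil Φ α B).PosSemidef)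
    (hlt : ∀ k, 0 < k → k < r → ∀ B ∈ K k, IsUnit (pencil Φ α B))
    {k : ℕ} (hk : 0 < k) {B : Matrix (Fin k) (Fin k) V} (hB : B ∈ K k)
    {Y : Matrix (Fin k) (Fin r) ℂ} (hY : Y ≠ 0) (h : pencil Φ α B *ᵥ Y.vec = 0) :
    Y.rank = r := by
  obtain ⟨s, ι, ε, hs, hι, rfl⟩ := Y.exists_isometry_mul_eq
  rw [← hs]
  refine le_antisymm (hs ▸ Matrix.rank_le_width _) (not_lt.mp fun hsr => ?_)
  have hε : ε ≠ 0 := by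
    rintro rfl
    exact hY (Matrix.mul_zero _)
  have hs0 : 0 < s := by
    rw [Nat.pos_iff_ne_zero]
    rintro rfl
    exact hε (Subsingleton.elim _ _)
  have hιB := hK.mconj_mem hk hs0 hB hι
  exact not_isUnit_pencil_iff.mpr ⟨ε, hε, (pencil_mconj_mulVec_eq_zero_iff (hpos k hk B hB) hι
    (hpos s hs0 _ hιB) ε).mpr h⟩ (hlt s hs0 hsr _ hιB)

lemma isUnit_of_pencil_mulVec_eq_zero (hK : IsMatrixConvex K)
    (hpos : ∀ k, 0 < k → ∀ B ∈ K k, (pencil Φ α B).PosSemidef)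
    (hlt : ∀ k, 0 < k → k < r → ∀ B ∈ K k, IsUnit (pencil Φ α B))
    (hr : 0 < r) {B : Matrix (Fin r) (Fin r) V} (hB : B ∈ K r)
    {Y : Matrix (Fin r) (Fin r) ℂ} (hY : Y ≠ 0) (h : pencil Φ α B *ᵥ Y.vec = 0) :
    IsUnit Y := by
  have hrank := rank_eq_of_pencil_mulVec_eq_zero hK hpos hlt hr hB hY h
  rw [← Matrix.mulVec_surjective_iff_isUnit, ← Matrix.coe_mulVecLin, ← LinearMap.range_eq_top]
  exact Submodule.eq_top_of_finrank_eq (by simpa [Matrix.rank] using hrank)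

/-- The kernel of the pencil at the level of the exposed point is at most one-dimensional. -/
lemma exists_eq_smul_of_pencil_mulVec_eq_zero (hK : IsMatrixConvex K)
    (hpos : ∀ k, 0 < k → ∀ B ∈ K k, (pencil Φ α B).PosSemidef)
    (hlt : ∀ k, 0 < k → k < r → ∀ B ∈ K k, IsUnit (pencil Φ α B))
    (hr : 0 < r) {B : Matrix (Fin r) (Fin r) V} (hB : B ∈ K r)
    {X Y : Matrix (Fin r) (Fin r) ℂ} (hX : X ≠ 0) (hBX : pencil Φ α B *ᵥ X.vec = 0)
    (hBY : pencil Φ α B *ᵥ Y.vec = 0) : ∃ z : ℂ, Y = z • X := by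
  have : NeZero r := ⟨hr.ne'⟩
  have hXu := isUnit_of_pencil_mulVec_eq_zero hK hpos hlt hr hB hX hBX
  obtain ⟨z, hz⟩ := spectrum.nonempty_of_isAlgClosed_of_finiteDimensional ℂ (X⁻¹ * Y)
  have heq : X * (algebraMap ℂ (Matrix (Fin r) (Fin r) ℂ) z - X⁻¹ * Y) = z • X - Y := by
    rw [mul_sub, Algebra.algebraMap_eq_smul_one, mul_smul_comm, mul_one,
      Matrix.mul_nonsing_inv_cancel_left _ _ ((Matrix.isUnit_iff_isUnit_det _).mp hXu)]
  refine ⟨z, ?_⟩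
  by_contra hne
  have hne' : z • X - Y ≠ 0 := fun h => hne (sub_eq_zero.mp h).symm
  have hu := isUnit_of_pencil_mulVec_eq_zero hK hpos hlt hr hB hne' (by
    rw [Matrix.vec_sub, Matrix.vec_smul, Matrix.mulVec_sub, Matrix.mulVec_smul, hBX, hBY,
      smul_zero, sub_zero])
  rw [← heq, hXu.mul_left_iff] at hu
  exact hz hu

/-- The point of `Γ_r(K)` given by `B` and `δ` is determined by a vanishing pencil form. -/
lemma eq_of_pencil_mulVec_eq_zero (hK : IsMatrixConvex K)
    (hpos : ∀ k, 0 < k → ∀ B ∈ K k, (pencil Φ α B).PosSemidef)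
    (hlt : ∀ k, 0 < k → k < r → ∀ B ∈ K k, IsUnit (pencil Φ α B))
    (hexp : ∀ B ∈ K r, ¬ IsUnit (pencil Φ α B) →
      ∃ U ∈ Matrix.unitaryGroup (Fin r) ℂ, B = mconj U A)
    (hr : 0 < r) (hA : A ∈ K r) {γ c : Matrix (Fin r) (Fin r) ℂ} (hc : IsUnit c)
    (htr : (γᴴ * γ).trace = 1) (hγc : γ * c ≠ 0) (hker : pencil Φ α A *ᵥ (γ * c).vec = 0)
    {k : ℕ} (hk : 0 < k) {B : Matrix (Fin k) (Fin k) V} (hB : B ∈ K k)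
    {δ : Matrix (Fin k) (Fin r) ℂ} (hδ : (δᴴ * δ).trace = 1)
    (hBδ : pencil Φ α B *ᵥ (δ * c).vec = 0) :
    δᴴ * δ = γᴴ * γ ∧ mconj δ B = mconj γ A := by
  have hcd := (Matrix.isUnit_iff_isUnit_det _).mp hc
  have hδc : δ * c ≠ 0 := by
    intro h
    have : δ = 0 := by rw [← Matrix.mul_nonsing_inv_cancel_right c δ hcd, h, Matrix.zero_mul]
    simp [this] at hδ
  obtain ⟨s, ι, Y, hs, hι, hY⟩ := (δ * c).exists_isometry_mul_eq
  obtain rfl : s = r :=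
    hs.trans (rank_eq_of_pencil_mulVec_eq_zero hK hpos hlt hk hB hδc hBδ)
  have hY0 : Y ≠ 0 := by
    rintro rfl
    exact hδc (hY.trans (Matrix.mul_zero _))
  have hιB := hK.mconj_mem hk hr hB hι
  have hιBY : pencil Φ α (mconj ι B) *ᵥ Y.vec = 0 := by
    rwa [pencil_mconj_mulVec_eq_zero_iff (hpos k hk B hB) hι (hpos s hr _ hιB), ← hY]
  obtain ⟨U, hU, hUA⟩ := hexp _ hιB (not_isUnit_pencil_iff.mpr ⟨Y, hY0, hιBY⟩)
  have hU₁ : Uᴴ * U = 1 := Matrix.mem_unitaryGroup_iff'.mp hU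
  have hU₂ : U * Uᴴ = 1 := Matrix.mem_unitaryGroup_iff.mp hU
  rw [hUA, pencil_mconj_mulVec_eq_zero_iff (hpos s hr A hA) hU₁ (hUA ▸ hpos s hr _ hιB)] at hιBY
  obtain ⟨z, hz⟩ := exists_eq_smul_of_pencil_mulVec_eq_zero hK hpos hlt hr hA hγc hker hιBY
  have hδ_eq : δ = z • ((ι * Uᴴ) * γ) := by
    rw [← Matrix.mul_nonsing_inv_cancel_right c δ hcd, hY, ← Matrix.one_mul Y, ← hU₁,
      Matrix.mul_assoc Uᴴ, hz, Matrix.mul_smul, Matrix.mul_smul, Matrix.smul_mul,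
      ← Matrix.mul_assoc, ← Matrix.mul_assoc, Matrix.mul_nonsing_inv_cancel_right c _ hcd]
  have hW : (ι * Uᴴ)ᴴ * (ι * Uᴴ) = 1 := by
    rw [Matrix.conjTranspose_mul, Matrix.mul_assoc, ← Matrix.mul_assoc ιᴴ, hι, Matrix.one_mul,
      Matrix.conjTranspose_conjTranspose, hU₂]
  have hWB : mconj (ι * Uᴴ) B = A := by rw [mconj_mul, hUA, ← mconj_mul, hU₂, mconj_one]
  have hsq : δᴴ * δ = (star z * z) • (γᴴ * γ) := by
    rw [hδ_eq, Matrix.conjTranspose_smul, Matrix.smul_mul, Matrix.mul_smul, smul_smul,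
      Matrix.conjTranspose_mul, Matrix.mul_assoc, ← Matrix.mul_assoc _ _ γ, hW, Matrix.one_mul]
  have hz1 : star z * z = 1 := by
    rwa [hsq, Matrix.trace_smul, htr, smul_eq_mul, mul_one] at hδ
  refine ⟨by rw [hsq, hz1, one_smul], ?_⟩
  rw [hδ_eq, mconj_smul_left, hz1, one_smul, mconj_mul, hWB]

end Exposed

/-- The functional `(M, W) ↦ pencilForm Φ α (c* M c) (c* W c)` as a continuous linear map. -/
noncomputable def pencilFunctional [TopologicalSpace V] [ContinuousAdd V] [ContinuousConstSMul ℂ V]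
    {r : ℕ} (Φ : V →L[ℂ] Matrix (Fin r) (Fin r) ℂ) (α c : Matrix (Fin r) (Fin r) ℂ) :
    (Matrix (Fin r) (Fin r) ℂ × Matrix (Fin r) (Fin r) V) →L[ℂ] ℂ where
  toFun P := pencilForm (Φ : V →ₗ[ℂ] _) α (cᴴ * P.1 * c) (mconj c P.2)
  map_add' P Q := by
    simp only [pencilForm, Prod.fst_add, Prod.snd_add, mconj_add, Matrix.add_mul,
      Matrix.add_apply, map_add, mul_add, Finset.sum_add_distrib]
    ring
  map_smul' z P := by
    simp only [pencilForm, Prod.smul_fst, Prod.smul_snd, mconj_smul, Matrix.mul_smul,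
      Matrix.smul_mul, Matrix.smul_apply, map_smul, smul_eq_mul, RingHom.id_apply, mul_sub,
      Finset.mul_sum, mul_left_comm z]
  cont := by
    have hconj (p q : Fin r) : Continuous fun P : Matrix (Fin r) (Fin r) ℂ ×
        Matrix (Fin r) (Fin r) V => mconj c P.2 p q := by
      simp only [mconj, Matrix.of_apply]
      refine continuous_finsetSum _ fun k _ => continuous_finsetSum _ fun l _ => ?_
      exact (continuous_snd.matrix_elem k l).const_smul _
    refine .sub (continuous_finsetSum _ fun p _ => continuous_finsetSum _ fun q _ => ?_)
      (continuous_finsetSum _ fun p _ => continuous_finsetSum _ fun q _ => ?_)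
    · exact (Φ.continuous.comp (hconj p q)).matrix_elem p q
    · exact continuous_const.mul
        (((continuous_const.matrix_mul continuous_fst).matrix_mul continuous_const).matrix_elem p q)

lemma pencilFunctional_apply [TopologicalSpace V] [ContinuousAdd V] [ContinuousConstSMul ℂ V]
    {k r : ℕ} (Φ : V →L[ℂ] Matrix (Fin r) (Fin r) ℂ) (α c : Matrix (Fin r) (Fin r) ℂ)
    (δ : Matrix (Fin k) (Fin r) ℂ) (B : Matrix (Fin k) (Fin k) V) :
    pencilFunctional Φ α c (δᴴ * δ, mconj δ B) =
      pencilForm (Φ : V →ₗ[ℂ] _) α ((δ * c)ᴴ * (δ * c)) (mconj (δ * c) B) := by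
  rw [mconj_mul, Matrix.conjTranspose_mul, Matrix.mul_assoc cᴴ, ← Matrix.mul_assoc δᴴ,
    ← Matrix.mul_assoc cᴴ]
  rfl

/-- A matrix exposed point of `K` yields exposed points of `Γ_r(K)`, for any topology on `V` making
addition and scalar multiplications continuous. -/
theorem IsMatrixExposed.isExposedPoint_gammaSet [TopologicalSpace V] [ContinuousAdd V]
    [ContinuousConstSMul ℂ V] {K : ∀ n : ℕ, Set (Matrix (Fin n) (Fin n) V)}
    (hK : IsMatrixConvex K) (h0 : (0 : Matrix (Fin 1) (Fin 1) V) ∈ K 1)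
    (hnz : ∃ w ∈ K 1, w ≠ 0) {r : ℕ} (hr : 0 < r) {A : Matrix (Fin r) (Fin r) V} (hA : A ∈ K r)
    (hAe : IsMatrixExposed K A) {γ : Matrix (Fin r) (Fin r) ℂ} (hγ : IsUnit γ)
    (htr : (γᴴ * γ).trace = 1) : IsExposedPoint (GammaSet K r) (γᴴ * γ, mconj γ A) := by
  obtain ⟨w, hw, hw0⟩ := hnz
  obtain ⟨Φ, α, -, hpos, hset⟩ := hAe
  have hpos : ∀ k, 0 < k → ∀ B ∈ K k,
      (pencil (Φ : V →ₗ[ℂ] Matrix (Fin r) (Fin r) ℂ) α B).PosSemidef := hpos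
  have hsing : ∀ B, (B ∈ K r ∧ (pencil (Φ : V →ₗ[ℂ] Matrix (Fin r) (Fin r) ℂ) α B).PosSemidef ∧
      ¬ IsUnit (pencil (Φ : V →ₗ[ℂ] Matrix (Fin r) (Fin r) ℂ) α B)) ↔
      ∃ U ∈ Matrix.unitaryGroup (Fin r) ℂ, B = mconj U A := fun B => Set.ext_iff.mp hset B
  have hexp : ∀ B ∈ K r, ¬ IsUnit (pencil (Φ : V →ₗ[ℂ] Matrix (Fin r) (Fin r) ℂ) α B) →
      ∃ U ∈ Matrix.unitaryGroup (Fin r) ℂ, B = mconj U A :=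
    fun B hB hs => (hsing B).mp ⟨hB, hpos r hr B hB, hs⟩
  have hlt : ∀ k, 0 < k → k < r → ∀ B ∈ K k,
      IsUnit (pencil (Φ : V →ₗ[ℂ] Matrix (Fin r) (Fin r) ℂ) α B) :=
    fun k hk hkr B hB => not_pencil_singular_of_lt hK h0 hw hw0 hpos hexp hk hkr hB
  obtain ⟨X, hX, hAX⟩ := not_isUnit_pencil_iff.mp
    ((hsing A).mpr ⟨1, one_mem _, (mconj_one A).symm⟩).2.2
  have hγX : γ * (γ⁻¹ * X) = X :=
    Matrix.mul_nonsing_inv_cancel_left _ _ ((Matrix.isUnit_iff_isUnit_det _).mp hγ)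
  have hc : IsUnit (γ⁻¹ * X) := by
    rw [← hγ.mul_left_iff, hγX]
    exact isUnit_of_pencil_mulVec_eq_zero hK hpos hlt hr hA hX hAX
  refine ⟨⟨r, hr, A, γ, hA, htr, rfl⟩, pencilFunctional Φ α (γ⁻¹ * X), 0, ?_, ?_⟩
  · rw [pencilFunctional_apply, ← pencil_mulVec_eq_zero_iff (hpos r hr A hA), hγX]
    exact hAX
  · rintro _ ⟨k, hk, B, δ, hB, hδ, rfl⟩ hne
    rw [pencilFunctional_apply]
    refine lt_of_le_of_ne (re_pencilForm_nonpos (hpos k hk B hB) _) fun h => hne ?_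
    rw [← pencil_mulVec_eq_zero_iff (hpos k hk B hB)] at h
    obtain ⟨h₁, h₂⟩ := eq_of_pencil_mulVec_eq_zero hK hpos hlt hexp hr hA hc htr
      (by rwa [hγX]) (by rwa [hγX]) hk hB hδ h
    rw [h₁, h₂]

end MatrixConvex

section Statements

variable {E F' : Type*} [AddCommGroup E] [Module ℂ E] [AddCommGroup F'] [Module ℂ F']
theorem matrixExposed_implies_gamma_exposed
    (p : E →ₗ[ℂ] F' →ₗ[ℂ] ℂ)
    (K : ∀ n : ℕ, Set (Matrix (Fin n) (Fin n) (WeakBilin p)))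
    (hK : IsMatrixConvex K)
    (h0 : (0 : Matrix (Fin 1) (Fin 1) (WeakBilin p)) ∈ K 1)
    (hnz : ∃ w ∈ K 1, w ≠ 0)
    (r : ℕ) (hr : 0 < r)
    (A : Matrix (Fin r) (Fin r) (WeakBilin p)) (hA : A ∈ K r)
    (hAe : IsMatrixExposed K A)
    (γ : Matrix (Fin r) (Fin r) ℂ) (hγ : IsUnit γ) (htr : (γᴴ * γ).trace = 1) :
    IsExposedPoint (GammaSet K r) (γᴴ * γ, mconj γ A) := by
  exact hAe.isExposedPoint_gammaSet hK h0 hnz hr hA hγ htr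

end Statements
end

section
/- Let K = (K_n)_{n≥1} be a matrix convex set in a complex vector space V and let F ⊆ K_n be a matrix face of K. Then every C*-extreme point of F is a matrix extreme point of K. -/
open scoped Matrix Kronecker ComplexOrder

section Statements

variable {E F' : Type*} [AddCommGroup E] [Module ℂ E] [AddCommGroup F'] [Module ℂ F']
theorem cstarExtreme_of_matrixFace_isMatrixExtreme
    {V : Type*} [AddCommGroup V] [Module ℂ V]
    (K : ∀ n : ℕ, Set (Matrix (Fin n) (Fin n) V))
    (hK : IsMatrixConvex K)
    (n : ℕ) (hn : 0 < n)
    (F : Set (Matrix (Fin n) (Fin n) V)) (hF : IsMatrixFace K F)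
    (A : Matrix (Fin n) (Fin n) V) (hA : IsCStarExtreme F A) :
    IsMatrixExtreme K A := by
  refine ⟨hF.1 hA.1, fun k hk ns Ai γ hpos hAi hγ hsum hcomb => ?_⟩
  have hface := hF.2.2 k hk ns Ai γ hpos hAi hγ hsum (hcomb ▸ hA.1)
  obtain rfl : ns = fun _ => n := funext fun i => (hface i).1
  have hAiF : ∀ i, Ai i ∈ F := fun i => by
    obtain ⟨_, h⟩ := hface i
    simpa using h
  intro i
  obtain ⟨U, hU, hUA⟩ := hA.2 k hk Ai γ hAiF
    (fun i => Matrix.mulVec_surjective_iff_isUnit.mp (hγ i)) hsum hcomb i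
  exact ⟨rfl, U, hU, by simpa using hUA⟩

end Statements
end

section
/- Let K = (K_n)_{n≥1} be a matrix convex set in V and let F ⊆ K_n be a nonempty matrix exposed face of K. Then F is an exposed face of the convex set K_n ⊆ M_n(V). -/
open scoped Matrix Kronecker ComplexOrder

/-- A convex set of singular positive semidefinite matrices has a common nonzero kernel vector. -/
theorem exists_common_kernel_of_convex {ι : Type*} [Fintype ι] [DecidableEq ι]
    {T : Set (Matrix ι ι ℂ)} (hT : Convex ℝ T) (hne : T.Nonempty)
    (hpos : ∀ A ∈ T, A.PosSemidef) (hsing : ∀ A ∈ T, ¬ IsUnit A) :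
    ∃ x : ι → ℂ, x ≠ 0 ∧ ∀ A ∈ T, A *ᵥ x = 0 := by
  obtain ⟨M, ⟨A, hA, rfl⟩, hmin⟩ := IsArtinian.set_has_minimal
    ((fun A : Matrix ι ι ℂ => LinearMap.ker A.mulVecLin) '' T) (hne.image _)
  have hle : ∀ B ∈ T, LinearMap.ker A.mulVecLin ≤ LinearMap.ker B.mulVecLin := by
    intro B hB
    set C : Matrix ι ι ℂ := (1 / 2 : ℝ) • A + (1 / 2 : ℝ) • B with hC_def
    have hC : C ∈ T := hT hA hB (by norm_num) (by norm_num) (by norm_num)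
    have hker : ∀ x : ι → ℂ, C *ᵥ x = 0 → A *ᵥ x = 0 ∧ B *ᵥ x = 0 := by
      intro x hx
      have hAx := (hpos A hA).dotProduct_mulVec_nonneg x
      have hBx := (hpos B hB).dotProduct_mulVec_nonneg x
      have hsum : star x ⬝ᵥ (A *ᵥ x) + star x ⬝ᵥ (B *ᵥ x) = 0 := by
        have h : star x ⬝ᵥ (C *ᵥ x) = 0 := by rw [hx, dotProduct_zero]
        rw [hC_def, ← smul_add, Matrix.smul_mulVec, dotProduct_smul, Matrix.add_mulVec,
          dotProduct_add] at h
        exact (smul_eq_zero.mp h).resolve_left (by norm_num)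
      obtain ⟨hA0, hB0⟩ := (add_eq_zero_iff_of_nonneg hAx hBx).mp hsum
      exact ⟨((hpos A hA).dotProduct_mulVec_zero_iff x).mp hA0,
        ((hpos B hB).dotProduct_mulVec_zero_iff x).mp hB0⟩
    have hCA : LinearMap.ker C.mulVecLin ≤ LinearMap.ker A.mulVecLin :=
      fun x hx => (hker x hx).1
    have hAC : LinearMap.ker C.mulVecLin = LinearMap.ker A.mulVecLin :=
      hCA.eq_of_not_lt (hmin _ ⟨C, hC, rfl⟩)
    rw [← hAC]
    exact fun x hx => (hker x hx).2
  have hdet : A.det = 0 := by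
    by_contra h
    exact hsing A hA ((Matrix.isUnit_iff_isUnit_det A).mpr (isUnit_iff_ne_zero.mpr h))
  obtain ⟨x, hx, hAx⟩ := Matrix.exists_mulVec_eq_zero_iff.mpr hdet
  exact ⟨x, hx, fun B hB => hle B hB hAx⟩

theorem re_dotProduct_reM_mulVec {ι : Type*} [Fintype ι] (X : Matrix ι ι ℂ) (x : ι → ℂ) :
    (star x ⬝ᵥ (reM X *ᵥ x)).re = (star x ⬝ᵥ (X *ᵥ x)).re := by
  have h : star x ⬝ᵥ (Xᴴ *ᵥ x) = star (star x ⬝ᵥ (X *ᵥ x)) := by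
    rw [Matrix.star_dotProduct, Matrix.star_mulVec, ← Matrix.dotProduct_mulVec,
      Matrix.conjTranspose_conjTranspose]
  rw [reM, Matrix.smul_mulVec, dotProduct_smul, Matrix.add_mulVec, dotProduct_add, h]
  simp [Complex.mul_re]
  ring

theorem reM_amplify_real_combination {V : Type*} [AddCommGroup V] [Module ℂ V] {m r : ℕ}
    (Φ : V →ₗ[ℂ] Matrix (Fin m) (Fin m) ℂ) (a b : ℝ) (A B : Matrix (Fin r) (Fin r) V) :
    reM (amplify Φ (a • A + b • B)) = a • reM (amplify Φ A) + b • reM (amplify Φ B) := by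
  ext p q
  simp [reM, amplify, LinearMap.map_smul_of_tower]
  ring

/-- The functional `B ↦ ⟨x, Φ_r(B) x⟩`. -/
noncomputable def amplifyForm {V : Type*} [AddCommGroup V] [Module ℂ V] [TopologicalSpace V] {m r : ℕ}
    (Φ : V →L[ℂ] Matrix (Fin m) (Fin m) ℂ) (x : Fin m × Fin r → ℂ) :
    Matrix (Fin r) (Fin r) V →L[ℂ] ℂ where
  toFun B := star x ⬝ᵥ (amplify (⇑Φ) B *ᵥ x)
  map_add' A B := by
    have h : amplify (⇑Φ) (A + B) = amplify (⇑Φ) A + amplify (⇑Φ) B := by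
      ext; simp [amplify]
    rw [h, Matrix.add_mulVec, dotProduct_add]
  map_smul' c A := by
    have h : amplify (⇑Φ) (c • A) = c • amplify (⇑Φ) A := by
      ext; simp [amplify]
    rw [h, Matrix.smul_mulVec, dotProduct_smul, RingHom.id_apply]
  cont := by
    have h : Continuous fun B : Matrix (Fin r) (Fin r) V => amplify (⇑Φ) B :=
      continuous_matrix fun p q =>
        (Φ.continuous.comp (continuous_id.matrix_elem p.2 q.2)).matrix_elem p.1 q.1
    exact continuous_const.dotProduct (h.matrix_mulVec continuous_const)

section Statements

variable {E F' : Type*} [AddCommGroup E] [Module ℂ E] [AddCommGroup F'] [Module ℂ F']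
theorem matrixExposedFace_isExposedFace
    (p : E →ₗ[ℂ] F' →ₗ[ℂ] ℂ)
    (K : ∀ n : ℕ, Set (Matrix (Fin n) (Fin n) (WeakBilin p)))
    (hK : IsMatrixConvex K)
    (n : ℕ) (hn : 0 < n)
    (F : Set (Matrix (Fin n) (Fin n) (WeakBilin p)))
    (hFne : F.Nonempty) (hF : IsMatrixExposedFace K F) :
    IsExposedFaceOf (K n) F := by
  obtain ⟨hFK, hconv, Φ, α, -, hpos, -, hface⟩ := hF
  set L : Matrix (Fin n) (Fin n) (WeakBilin p) → Matrix (Fin n × Fin n) (Fin n × Fin n) ℂ :=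
    fun B => α ⊗ₖ (1 : Matrix (Fin n) (Fin n) ℂ) - reM (amplify (⇑Φ) B) with hL
  have hmem : ∀ B, B ∈ F ↔ B ∈ K n ∧ (L B).PosSemidef ∧ ¬ IsUnit (L B) := fun B => by
    rw [← hface]; rfl
  have hT : Convex ℝ (L '' F) := by
    rintro _ ⟨A, hA, rfl⟩ _ ⟨B, hB, rfl⟩ a b ha hb hab
    refine ⟨a • A + b • B, hconv hA hB ha hb hab, ?_⟩
    have h := reM_amplify_real_combination Φ.toLinearMap a b A B
    refine (congrArg (α ⊗ₖ (1 : Matrix (Fin n) (Fin n) ℂ) - ·) h).trans ?_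
    simp only [hL]
    rw [smul_sub, smul_sub, sub_add_sub_comm, ← add_smul, hab, one_smul]
    rfl
  obtain ⟨x, hx0, hx⟩ := exists_common_kernel_of_convex hT (hFne.image L)
    (by rintro _ ⟨B, hB, rfl⟩; exact ((hmem B).mp hB).2.1)
    (by rintro _ ⟨B, hB, rfl⟩; exact ((hmem B).mp hB).2.2)
  have hform : ∀ B, (amplifyForm Φ x B).re =
      (star x ⬝ᵥ ((α ⊗ₖ (1 : Matrix (Fin n) (Fin n) ℂ)) *ᵥ x)).re
        - (star x ⬝ᵥ (L B *ᵥ x)).re := by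
    intro B
    change (star x ⬝ᵥ (amplify (⇑Φ) B *ᵥ x)).re = _
    rw [hL, Matrix.sub_mulVec, dotProduct_sub, Complex.sub_re, re_dotProduct_reM_mulVec]
    ring
  refine ⟨hFK, amplifyForm Φ x,
    (star x ⬝ᵥ ((α ⊗ₖ (1 : Matrix (Fin n) (Fin n) ℂ)) *ᵥ x)).re, fun B hB => ?_, fun B hB hBF => ?_⟩
  · rw [hform, hx _ ⟨B, hB, rfl⟩, dotProduct_zero, Complex.zero_re, sub_zero]
  · have hBpos : (L B).PosSemidef := hpos n hn B hB
    have hunit : IsUnit (L B) := by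
      by_contra h
      exact hBF ((hmem B).mpr ⟨hB, hBpos, h⟩)
    have h := (hBpos.posDef_iff_isUnit.mpr hunit).re_dotProduct_pos hx0
    rw [hform]
    exact sub_lt_self _ h

end Statements
end

section
/- Let K = (K_n)_{n≥1} be a matrix convex set in V and let F be a matrix exposed face of K with F ⊊ K_n (a proper subset). Then F is a matrix face of K. -/
open scoped Matrix Kronecker ComplexOrder

section Pencil

open Matrix

variable {V : Type*} [AddCommGroup V] [Module ℂ V]

/-- The value `α ⊗ 1 - Re Φ_r(B)` of the affine pencil defined by `(Φ, α)`. -/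
noncomputable def facePencil {m r : ℕ} (Φ : V →ₗ[ℂ] Matrix (Fin m) (Fin m) ℂ) (α : Matrix (Fin m) (Fin m) ℂ)
    (B : Matrix (Fin r) (Fin r) V) : Matrix (Fin m × Fin r) (Fin m × Fin r) ℂ :=
  α ⊗ₖ (1 : Matrix (Fin r) (Fin r) ℂ) - reM (amplify (⇑Φ) B)

lemma amplify_mconj {m r s : ℕ} (Φ : V →ₗ[ℂ] Matrix (Fin m) (Fin m) ℂ)
    (γ : Matrix (Fin s) (Fin r) ℂ) (A : Matrix (Fin s) (Fin s) V) :
    amplify (⇑Φ) (mconj γ A) =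
      ((1 : Matrix (Fin m) (Fin m) ℂ) ⊗ₖ γ)ᴴ * amplify (⇑Φ) A *
        ((1 : Matrix (Fin m) (Fin m) ℂ) ⊗ₖ γ) := by
  ext ⟨a, p⟩ ⟨b, q⟩
  simp only [amplify, mconj, Matrix.of_apply, map_sum, map_smul, Matrix.sum_apply,
    Matrix.smul_apply, smul_eq_mul, Matrix.mul_apply, Matrix.conjTranspose_apply,
    Matrix.kroneckerMap_apply, Fintype.sum_prod_type, Matrix.one_apply, ite_mul,
    one_mul, zero_mul, apply_ite star, star_zero, mul_ite, mul_zero,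
    Finset.sum_ite_irrel, Finset.sum_const_zero, Finset.sum_ite_eq',
    Finset.mem_univ, if_true]
  rw [Finset.sum_comm]
  refine Finset.sum_congr rfl fun l _ => ?_
  rw [Finset.sum_mul]
  exact Finset.sum_congr rfl fun k _ => by ring

lemma amplify_sum {ι : Type*} {m r : ℕ} (Φ : V →ₗ[ℂ] Matrix (Fin m) (Fin m) ℂ)
    (s : Finset ι) (B : ι → Matrix (Fin r) (Fin r) V) :
    amplify (⇑Φ) (∑ i ∈ s, B i) = ∑ i ∈ s, amplify (⇑Φ) (B i) := by
  ext p q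
  simp [amplify, Matrix.sum_apply]

lemma reM_sum {ι κ : Type*} (s : Finset ι) (X : ι → Matrix κ κ ℂ) :
    reM (∑ i ∈ s, X i) = ∑ i ∈ s, reM (X i) := by
  simp only [reM, Matrix.conjTranspose_sum, ← Finset.sum_add_distrib, Finset.smul_sum]

lemma reM_conj {ι κ : Type*} [Fintype ι] (G : Matrix ι κ ℂ) (X : Matrix ι ι ℂ) :
    reM (Gᴴ * X * G) = Gᴴ * reM X * G := by
  simp only [reM, Matrix.conjTranspose_mul, Matrix.conjTranspose_conjTranspose, Matrix.mul_smul,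
    Matrix.smul_mul, Matrix.mul_add, Matrix.add_mul, Matrix.mul_assoc]

lemma facePencil_sum_mconj {ι : Type*} [Fintype ι] {m r : ℕ}
    (Φ : V →ₗ[ℂ] Matrix (Fin m) (Fin m) ℂ)
    (α : Matrix (Fin m) (Fin m) ℂ) (ns : ι → ℕ) (A : ∀ i, Matrix (Fin (ns i)) (Fin (ns i)) V)
    (γ : ∀ i, Matrix (Fin (ns i)) (Fin r) ℂ) (hγ : ∑ i, (γ i)ᴴ * γ i = 1) :
    facePencil Φ α (∑ i, mconj (γ i) (A i)) =
      ∑ i, ((1 : Matrix (Fin m) (Fin m) ℂ) ⊗ₖ γ i)ᴴ * facePencil Φ α (A i) *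
        ((1 : Matrix (Fin m) (Fin m) ℂ) ⊗ₖ γ i) := by
  have hα : α ⊗ₖ (1 : Matrix (Fin r) (Fin r) ℂ) =
      ∑ i, ((1 : Matrix (Fin m) (Fin m) ℂ) ⊗ₖ γ i)ᴴ *
        (α ⊗ₖ (1 : Matrix (Fin (ns i)) (Fin (ns i)) ℂ)) *
        ((1 : Matrix (Fin m) (Fin m) ℂ) ⊗ₖ γ i) := by
    simp only [Matrix.conjTranspose_kronecker, ← Matrix.mul_kronecker_mul,
      Matrix.conjTranspose_one, Matrix.one_mul, Matrix.mul_one, ← hγ]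
    ext p q
    simp [Matrix.sum_apply, Matrix.kroneckerMap_apply, Finset.mul_sum]
  simp only [facePencil, amplify_sum, reM_sum, amplify_mconj, reM_conj, Matrix.mul_sub,
    Matrix.sub_mul, Finset.sum_sub_distrib]
  rw [← hα]

lemma one_kronecker_mulVec {m r s : ℕ} (γ : Matrix (Fin s) (Fin r) ℂ)
    (X : Matrix (Fin r) (Fin m) ℂ) :
    ((1 : Matrix (Fin m) (Fin m) ℂ) ⊗ₖ γ) *ᵥ (fun p => X p.2 p.1) =
      fun p => (γ * X) p.2 p.1 := by
  ext ⟨a, p⟩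
  simp [Matrix.mulVec, dotProduct, Fintype.sum_prod_type, Matrix.one_apply, Matrix.mul_apply]

/-- Vectors in the kernel of a sum of compressions of positive semidefinite matrices are mapped
into the kernel of each summand. -/
lemma mulVec_eq_zero_of_sum_conj {ι κ : Type*} [Fintype ι] [Fintype κ] {τ : ι → Type*}
    [∀ i, Fintype (τ i)]
    (L : ∀ i, Matrix (τ i) (τ i) ℂ) (G : ∀ i, Matrix (τ i) κ ℂ) (hL : ∀ i, (L i).PosSemidef)
    (x : κ → ℂ) (hx : (∑ i, (G i)ᴴ * L i * G i) *ᵥ x = 0) (i : ι) :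
    L i *ᵥ (G i *ᵥ x) = 0 := by
  have key : ∀ j, star x ⬝ᵥ (((G j)ᴴ * L j * G j) *ᵥ x) =
      star (G j *ᵥ x) ⬝ᵥ (L j *ᵥ (G j *ᵥ x)) := fun j => by
    rw [Matrix.star_mulVec, ← Matrix.dotProduct_mulVec, Matrix.mulVec_mulVec,
      Matrix.mulVec_mulVec, Matrix.mul_assoc]
  have hsum : ∑ j, star (G j *ᵥ x) ⬝ᵥ (L j *ᵥ (G j *ᵥ x)) = 0 := by
    have h := congrArg (star x ⬝ᵥ ·) hx
    simpa only [Matrix.sum_mulVec, dotProduct_sum, key, dotProduct_zero] using h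
  have h0 := (Finset.sum_eq_zero_iff_of_nonneg
    fun j _ => (hL j).dotProduct_mulVec_nonneg _).1 hsum i (Finset.mem_univ i)
  exact ((hL i).dotProduct_mulVec_zero_iff _).1 h0

/-- A nonzero singular square matrix factors through an isometry from a smaller space. -/
lemma exists_isometry_factor {n : ℕ} (X : Matrix (Fin n) (Fin n) ℂ) (hX : X ≠ 0)
    (hdet : X.det = 0) :
    ∃ m, 0 < m ∧ m < n ∧ ∃ (β : Matrix (Fin n) (Fin m) ℂ) (Y : Matrix (Fin m) (Fin n) ℂ),
      βᴴ * β = 1 ∧ X = β * Y := by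
  let W : Submodule ℂ (EuclideanSpace ℂ (Fin n)) :=
    LinearMap.range (Matrix.toEuclideanLin X)
  let b := stdOrthonormalBasis ℂ W
  let β : Matrix (Fin n) (Fin (Module.finrank ℂ W)) ℂ :=
    Matrix.of fun k j => (b j : EuclideanSpace ℂ (Fin n)) k
  have hβ : βᴴ * β = 1 := by
    ext i j
    have h := orthonormal_iff_ite.1 b.orthonormal i j
    rw [Submodule.coe_inner, PiLp.inner_apply] at h
    simpa [β, Matrix.mul_apply, Matrix.one_apply, mul_comm] using h
  have hmem : ∀ j, WithLp.toLp 2 (X.col j) ∈ W := fun j =>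
    ⟨WithLp.toLp 2 (Pi.single j 1), by simp [Matrix.toLpLin_apply]⟩
  let Y : Matrix (Fin (Module.finrank ℂ W)) (Fin n) ℂ :=
    Matrix.of fun k j => b.repr ⟨_, hmem j⟩ k
  have hXY : X = β * Y := by
    ext i j
    have h := congrArg (fun w : W => (w : EuclideanSpace ℂ (Fin n)) i)
      (b.sum_repr ⟨_, hmem j⟩)
    simp only [Submodule.coe_sum, WithLp.ofLp_sum, Finset.sum_apply, Submodule.coe_smul,
      PiLp.smul_apply, smul_eq_mul, Matrix.col_apply] at h
    rw [← h, Matrix.mul_apply]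
    exact Finset.sum_congr rfl fun k _ => mul_comm _ _
  refine ⟨Module.finrank ℂ W, ?_, ?_, β, Y, hβ, hXY⟩
  · by_contra h0
    have : IsEmpty (Fin (Module.finrank ℂ W)) := by
      rw [Nat.eq_zero_of_not_pos h0]; infer_instance
    apply hX
    ext i j
    simp [hXY, Matrix.mul_apply]
  · obtain ⟨v, hv, hXv⟩ := Matrix.exists_mulVec_eq_zero_iff.2 hdet
    have h1 := LinearMap.finrank_range_add_finrank_ker (Matrix.toEuclideanLin X)
    rw [finrank_euclideanSpace_fin] at h1
    have h2 : 0 < Module.finrank ℂ (LinearMap.ker (Matrix.toEuclideanLin X)) := by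
      rw [Module.finrank_pos_iff, Submodule.nontrivial_iff_ne_bot, Submodule.ne_bot_iff]
      exact ⟨WithLp.toLp 2 v, by simp [Matrix.toLpLin_apply, hXv], by simpa using hv⟩
    change Module.finrank ℂ (LinearMap.range (Matrix.toEuclideanLin X)) < n
    omega

/-- If the pencil is positive definite on all levels below `n`, then a nonzero vector in the
kernel of its value at a point of level `n`, read as an `n × n` matrix, is invertible. -/
lemma det_ne_zero_of_facePencil_mulVec_eq_zero
    {K : ∀ n : ℕ, Set (Matrix (Fin n) (Fin n) V)} (hK : IsMatrixConvex K) {n : ℕ} (hn : 0 < n)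
    (Φ : V →ₗ[ℂ] Matrix (Fin n) (Fin n) ℂ) (α : Matrix (Fin n) (Fin n) ℂ)
    (hpd : ∀ m, 0 < m → m < n → ∀ B ∈ K m, (facePencil Φ α B).PosDef)
    {A : Matrix (Fin n) (Fin n) V} (hA : A ∈ K n) {X : Matrix (Fin n) (Fin n) ℂ} (hX : X ≠ 0)
    (h : facePencil Φ α A *ᵥ (fun p => X p.2 p.1) = 0) : X.det ≠ 0 := by
  intro hdet
  obtain ⟨m, hm, hmn, β, Y, hβ, rfl⟩ := exists_isometry_factor X hX hdet
  have hβ' : ∑ _i : Fin 1, βᴴ * β = 1 := by simpa using hβ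
  have hB := hK 1 m one_pos hm (fun _ => n) (fun _ => A) (fun _ => β) (fun _ => hn)
    (fun _ => hA) hβ'
  have hP := facePencil_sum_mconj (ι := Fin 1) Φ α (fun _ => n) (fun _ => A) (fun _ => β) hβ'
  have hpos := hpd m hm hmn _ hB
  have hker : facePencil Φ α (∑ _i : Fin 1, mconj β A) *ᵥ (fun p => Y p.2 p.1) = 0 := by
    rw [hP, Fin.sum_univ_one, ← Matrix.mulVec_mulVec, one_kronecker_mulVec,
      ← Matrix.mulVec_mulVec, h, Matrix.mulVec_zero]
  have hY : (fun p : Fin n × Fin m => Y p.2 p.1) = 0 := by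
    by_contra hne
    exact hpos.isUnit.map Matrix.detMonoidHom |>.ne_zero
      (Matrix.exists_mulVec_eq_zero_iff.1 ⟨_, hne, hker⟩)
  apply hX
  have : Y = 0 := by
    ext i j
    exact congrFun hY (j, i)
  rw [this, Matrix.mul_zero]

/-- A matrix exposed face of a matrix convex set is a matrix face. -/
theorem IsMatrixExposedFace.isMatrixFace [TopologicalSpace V]
    {K : ∀ n : ℕ, Set (Matrix (Fin n) (Fin n) V)} (hK : IsMatrixConvex K) {n : ℕ} (hn : 0 < n)
    {F : Set (Matrix (Fin n) (Fin n) V)} (hF : IsMatrixExposedFace K F) : IsMatrixFace K F := by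
  obtain ⟨hFK, hconv, Φ, α, -, hpsd, hpd, hset⟩ := hF
  have hmemF : ∀ B, B ∈ F ↔ B ∈ K n ∧ (facePencil (Φ : V →ₗ[ℂ] _) α B).PosSemidef ∧
      ¬ IsUnit (facePencil (Φ : V →ₗ[ℂ] _) α B) := fun B => by rw [← hset]; rfl
  replace hpsd : ∀ m, 0 < m → ∀ B ∈ K m, (facePencil (Φ : V →ₗ[ℂ] _) α B).PosSemidef := hpsd
  replace hpd : ∀ m, 0 < m → m < n → ∀ B ∈ K m,
      (facePencil (Φ : V →ₗ[ℂ] _) α B).PosDef := hpd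
  clear hset
  generalize (Φ : V →ₗ[ℂ] Matrix (Fin n) (Fin n) ℂ) = Ψ at hmemF hpsd hpd
  refine ⟨hFK, hconv, fun k _ ns A γ hns hA hsurj hγ hmem i => ?_⟩
  obtain ⟨hAK, -, hsing⟩ := (hmemF _).1 hmem
  rw [Matrix.isUnit_iff_isUnit_det, isUnit_iff_ne_zero, not_not,
    ← Matrix.exists_mulVec_eq_zero_iff] at hsing
  obtain ⟨x, hx, hLx⟩ := hsing
  let X : Matrix (Fin n) (Fin n) ℂ := Matrix.of fun i j => x (j, i)
  have hX : X ≠ 0 := fun h0 => hx <| funext fun q => congrFun (congrFun h0 q.2) q.1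
  have hdet : X.det ≠ 0 := det_ne_zero_of_facePencil_mulVec_eq_zero hK hn _ α hpd hAK hX hLx
  rw [facePencil_sum_mconj _ α ns A γ hγ] at hLx
  have hker := mulVec_eq_zero_of_sum_conj (fun j => facePencil Ψ α (A j))
    (fun j => (1 : Matrix (Fin n) (Fin n) ℂ) ⊗ₖ γ j)
    (fun j => hpsd (ns j) (hns j) _ (hA j)) x hLx i
  have hne : ((1 : Matrix (Fin n) (Fin n) ℂ) ⊗ₖ γ i) *ᵥ x ≠ 0 := by
    intro h0
    have hγX : γ i * X = 0 := by
      ext a b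
      exact congrFun ((one_kronecker_mulVec (γ i) X).symm.trans h0) (b, a)
    have hγ0 : γ i = 0 := by
      rw [← Matrix.mul_nonsing_inv_cancel_right (A := X) (γ i) (isUnit_iff_ne_zero.2 hdet), hγX,
        Matrix.zero_mul]
    obtain ⟨v, hv⟩ := hsurj i (fun _ => 1)
    rw [hγ0, Matrix.zero_mulVec] at hv
    exact zero_ne_one (congrFun hv ⟨0, hns i⟩)
  have hsing : ¬ IsUnit (facePencil Ψ α (A i)) := by
    rw [Matrix.isUnit_iff_isUnit_det, isUnit_iff_ne_zero, not_not,
      ← Matrix.exists_mulVec_eq_zero_iff]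
    exact ⟨_, hne, hker⟩
  have hle : ns i ≤ n := by
    have h := LinearMap.finrank_le_finrank_of_surjective (f := (γ i).mulVecLin) (hsurj i)
    simpa using h
  have heq : ns i = n := hle.antisymm <| not_lt.1 fun hlt =>
    hsing (hpd (ns i) (hns i) hlt _ (hA i)).isUnit
  refine ⟨heq, ?_⟩
  have transfer : ∀ (r : ℕ) (h : r = n) (B : Matrix (Fin r) (Fin r) V), B ∈ K r →
      ¬ IsUnit (facePencil Ψ α B) →
      Matrix.reindex (finCongr h) (finCongr h) B ∈ K n ∧
      ¬ IsUnit (facePencil Ψ α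
        (Matrix.reindex (finCongr h) (finCongr h) B)) := by
    rintro r rfl B hB hs
    exact ⟨hB, hs⟩
  obtain ⟨h1, h2⟩ := transfer _ heq _ (hA i) hsing
  exact (hmemF _).2 ⟨h1, hpsd n hn _ h1, h2⟩

end Pencil

section Statements

variable {E F' : Type*} [AddCommGroup E] [Module ℂ E] [AddCommGroup F'] [Module ℂ F']
theorem matrixExposedFace_isMatrixFace
    (p : E →ₗ[ℂ] F' →ₗ[ℂ] ℂ)
    (K : ∀ n : ℕ, Set (Matrix (Fin n) (Fin n) (WeakBilin p)))
    (hK : IsMatrixConvex K)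
    (n : ℕ) (hn : 0 < n)
    (F : Set (Matrix (Fin n) (Fin n) (WeakBilin p)))
    (hF : IsMatrixExposedFace K F) (hFne : F ≠ K n) :
    IsMatrixFace K F := by
  exact hF.isMatrixFace hK hn

end Statements
end
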